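/- arXiv:2201.02774 — 10 statements merged into one kernel-verified Lean document; each statement's English description precedes it below -/
import Mathlib

section
/- For every m ≥ 100 and every q with 0 ≤ q ≤ 9.9, the finite-blocklength rate function r_{m,q} is strictly increasing on the interval (1, ∞); that is, for all γ₁, γ₂ with 1 < γ₁ < γ₂ one has r_{m,q}(γ₁) < r_{m,q}(γ₂). -/
noncomputable def rFBL (m q γ : ℝ) : ℝ :=
  Real.logb 2 (1 + γ)
    - (Real.sqrt (γ * (γ + 2)) / ((γ + 1) * Real.sqrt m)) * q * Real.logb 2 (Real.exp 1)
    + Real.logb 2 m / m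

/-- The square root of the channel dispersion grows more slowly than `Real.log`. -/
lemma sqrt_dispersion_sub_le {a b : ℝ} (ha : 2 < a) (hab : a < b) :
    √(b ^ 2 - 1) / b - √(a ^ 2 - 1) / a ≤ 1 - a / b := by
  have ha0 : 0 < a := by linarith
  have hb0 : 0 < b := by linarith
  have hA : √(a ^ 2 - 1) ^ 2 = a ^ 2 - 1 := Real.sq_sqrt (by nlinarith)
  have hB : √(b ^ 2 - 1) ^ 2 = b ^ 2 - 1 := Real.sq_sqrt (by nlinarith)
  have hA' : 1 / 2 ≤ √(a ^ 2 - 1) / a := by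
    rw [le_div_iff₀ ha0]
    exact Real.le_sqrt_of_sq_le (by nlinarith)
  have hB' : 1 / 2 ≤ √(b ^ 2 - 1) / b := by
    rw [le_div_iff₀ hb0]
    exact Real.le_sqrt_of_sq_le (by nlinarith)
  set s := √(a ^ 2 - 1) / a with hs
  set t := √(b ^ 2 - 1) / b with ht
  have hdiff : t ^ 2 - s ^ 2 = (1 - a / b) * ((a + b) / (a ^ 2 * b)) := by
    rw [hs, ht, div_pow, div_pow, hA, hB]
    field_simp
    ring
  have hfac : (a + b) / (a ^ 2 * b) ≤ 1 := by
    rw [div_le_one (by positivity)]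
    nlinarith [mul_pos (show 0 < a ^ 2 - 4 by nlinarith) hb0]
  have hpos : 0 ≤ 1 - a / b := by
    rw [sub_nonneg, div_le_one hb0]
    exact hab.le
  have hsq : t ^ 2 - s ^ 2 ≤ 1 - a / b := hdiff ▸ mul_le_of_le_one_right hpos hfac
  by_contra! h
  nlinarith

theorem stmt_0 (m q : ℝ) (hm : 100 ≤ m) (hq0 : 0 ≤ q) (hq1 : q ≤ 9.9)
    (γ₁ γ₂ : ℝ) (h1 : 1 < γ₁) (h12 : γ₁ < γ₂) :
    rFBL m q γ₁ < rFBL m q γ₂ := by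
  have ha : 2 < 1 + γ₁ := by linarith
  have hab : 1 + γ₁ < 1 + γ₂ := by linarith
  have hb0 : 0 < 1 + γ₂ := by linarith
  have hlog2 : 0 < Real.log 2 := Real.log_pos (by norm_num)
  have hsm : 10 ≤ √m := Real.le_sqrt_of_sq_le (by linarith)
  have hc1 : q / √m < 1 := by
    rw [div_lt_one (by linarith)]
    linarith
  have hc0 : 0 ≤ q / √m := by positivity
  have hdisp := sqrt_dispersion_sub_le ha hab
  have hlog : 1 - (1 + γ₁) / (1 + γ₂) ≤ Real.log (1 + γ₂) - Real.log (1 + γ₁) := by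
    have h := Real.one_sub_inv_le_log_of_pos (show 0 < (1 + γ₂) / (1 + γ₁) by positivity)
    rwa [inv_div, Real.log_div (by linarith) (by linarith)] at h
  have hpos : 0 < 1 - (1 + γ₁) / (1 + γ₂) := by
    rw [sub_pos, div_lt_one hb0]
    exact hab
  have key : Real.log (1 + γ₁) - q / √m * (√((1 + γ₁) ^ 2 - 1) / (1 + γ₁)) <
      Real.log (1 + γ₂) - q / √m * (√((1 + γ₂) ^ 2 - 1) / (1 + γ₂)) := by
    have h := mul_le_mul_of_nonneg_left hdisp hc0
    have h' := mul_lt_of_lt_one_left hpos hc1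
    linarith
  have rate_eq (γ : ℝ) : rFBL m q γ =
      (Real.log (1 + γ) - q / √m * (√((1 + γ) ^ 2 - 1) / (1 + γ))) / Real.log 2
        + Real.logb 2 m / m := by
    have h : γ * (γ + 2) = (1 + γ) ^ 2 - 1 := by ring
    unfold rFBL
    rw [h, add_comm γ 1, Real.logb, Real.logb, Real.log_exp, div_mul_eq_div_div]
    ring
  rw [rate_eq, rate_eq]
  gcongr
end

section
/- For every m ≥ 100 and every q with 0 ≤ q ≤ 9.9, the finite-blocklength rate function r_{m,q} is concave on the interval (1, ∞); that is, for all γ₁, γ₂ > 1 and all t ∈ [0,1], r_{m,q}(t·γ₁ + (1−t)·γ₂) ≥ t·r_{m,q}(γ₁) + (1−t)·r_{m,q}(γ₂). -/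
lemma hasDerivAt_sqrt_mul_add_two {x : ℝ} (hx : 1 < x) :
    HasDerivAt (fun y : ℝ => Real.sqrt (y * (y + 2))) ((x + 1) / Real.sqrt (x * (x + 2))) x := by
  have hpos : 0 < x * (x + 2) := by nlinarith
  have h := ((hasDerivAt_id x).mul ((hasDerivAt_id x).add_const 2)).sqrt hpos.ne'
  have hs := Real.sqrt_pos.2 hpos
  refine h.congr_deriv ?_
  simp only [id, Pi.mul_apply]
  field_simp
  ring

lemma three_mul_sq_sub_two_le {x s : ℝ} (hx : 1 < x) (hs : 0 < s)
    (hsq : s ^ 2 = x * (x + 2)) : 3 * (x + 1) ^ 2 - 2 ≤ (x + 1) * s ^ 3 := by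
  refine abs_le_of_sq_le_sq' ?_ (by positivity) |>.2
  have hs6 : ((x + 1) * s ^ 3) ^ 2 = (x + 1) ^ 2 * (x * (x + 2)) ^ 3 := by rw [← hsq]; ring
  rw [hs6]
  obtain ⟨t, ht, rfl⟩ : ∃ t : ℝ, 0 < t ∧ x = 1 + t := ⟨x - 1, by linarith, by ring⟩
  rw [← sub_nonneg]
  ring_nf
  positivity

/-- The extremal case of the rate function, with dispersion coefficient one. -/
lemma concaveOn_log_sub_sqrt_dispersion :
    ConcaveOn ℝ (Set.Ioi (1 : ℝ))
      (fun y => Real.log (1 + y) - Real.sqrt (y * (y + 2)) / (y + 1)) := by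
  have hd : ∀ x : ℝ, 1 < x → HasDerivAt
      (fun y => Real.log (1 + y) - Real.sqrt (y * (y + 2)) / (y + 1))
      (1 / (1 + x) - 1 / ((x + 1) ^ 2 * Real.sqrt (x * (x + 2)))) x := by
    intro x hx
    have hpos : 0 < x * (x + 2) := by nlinarith
    have hs := Real.sqrt_pos.2 hpos
    have hsq := Real.sq_sqrt hpos.le
    have h1 : (1 + x) ≠ 0 := by linarith
    have h2 : (x + 1) ≠ 0 := by linarith
    have h := (((hasDerivAt_id x).const_add 1).log h1).sub
      ((hasDerivAt_sqrt_mul_add_two hx).div ((hasDerivAt_id x).add_const 1) h2)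
    refine h.congr_deriv ?_
    simp only [id]
    generalize Real.sqrt (x * (x + 2)) = s at *
    congr 1
    field_simp
    linear_combination -hsq
  have hd2 : ∀ x : ℝ, 1 < x → HasDerivAt
      (fun y => 1 / (1 + y) - 1 / ((y + 1) ^ 2 * Real.sqrt (y * (y + 2))))
      (-((x + 1) * Real.sqrt (x * (x + 2)) ^ 3 - (3 * (x + 1) ^ 2 - 2))
        / ((x + 1) ^ 3 * Real.sqrt (x * (x + 2)) ^ 3)) x := by
    intro x hx
    have hpos : 0 < x * (x + 2) := by nlinarith
    have hs := Real.sqrt_pos.2 hpos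
    have hsq := Real.sq_sqrt hpos.le
    have h1 : (1 + x) ≠ 0 := by linarith
    have h2 : (x + 1) ≠ 0 := by linarith
    have h := ((hasDerivAt_const x (1 : ℝ)).div ((hasDerivAt_id x).const_add 1) h1).sub
      ((hasDerivAt_const x (1 : ℝ)).div
        ((((hasDerivAt_id x).add_const 1).pow 2).mul (hasDerivAt_sqrt_mul_add_two hx))
        (mul_ne_zero (pow_ne_zero 2 h2) hs.ne'))
    refine h.congr_deriv ?_
    simp only [id, Pi.mul_apply, Pi.pow_apply]
    generalize Real.sqrt (x * (x + 2)) = s at *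
    rw [add_comm 1 x]
    field_simp
    linear_combination (2 * x + 2) * hsq
  refine concaveOn_of_hasDerivWithinAt2_nonpos (convex_Ioi 1)
    (fun x hx => (hd x hx).continuousAt.continuousWithinAt)
    (fun x hx => (hd x (interior_subset hx)).hasDerivWithinAt)
    (fun x hx => (hd2 x (interior_subset hx)).hasDerivWithinAt) ?_
  intro x hx
  have hx : 1 < x := interior_subset hx
  have hpos : 0 < x * (x + 2) := by nlinarith
  have hs := Real.sqrt_pos.2 hpos
  have := three_mul_sq_sub_two_le hx hs (Real.sq_sqrt hpos.le)
  exact div_nonpos_of_nonpos_of_nonneg (by linarith) (by positivity)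

theorem stmt_1 (m q : ℝ) (hm : 100 ≤ m) (hq0 : 0 ≤ q) (hq1 : q ≤ 9.9) :
    ConcaveOn ℝ (Set.Ioi (1 : ℝ)) (rFBL m q) := by
  have hm10 : 10 ≤ Real.sqrt m := Real.le_sqrt_of_sq_le (by linarith)
  have hc0 : 0 ≤ q / Real.sqrt m := by positivity
  have hc1 : q / Real.sqrt m ≤ 1 := (div_le_one (by linarith)).2 (by norm_num at hq1; linarith)
  have hlog : ConcaveOn ℝ (Set.Ioi (1 : ℝ)) (fun y => Real.log (1 + y)) := by
    refine ((strictConcaveOn_log_Ioi.concaveOn.translate_right 1).subset ?_ (convex_Ioi 1))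
    intro y hy
    have : (1 : ℝ) < y := hy
    simp only [Set.mem_preimage, Set.mem_Ioi]
    linarith
  have h2 : 0 < Real.log 2 := Real.log_pos one_lt_two
  have h := (((hlog.smul (sub_nonneg.2 hc1)).add
    (concaveOn_log_sub_sqrt_dispersion.smul hc0)).smul (inv_nonneg.2 h2.le)).add_const
      (Real.logb 2 m / m)
  refine h.congr fun y hy => ?_
  have hy1 : (1 : ℝ) < y := hy
  have hy2 : y + 1 ≠ 0 := by linarith
  have hsm : Real.sqrt m ≠ 0 := by linarith
  simp only [rFBL, Pi.add_apply, smul_eq_mul, Real.logb, Real.log_exp, add_left_inj]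
  field_simp
  ring
end

section
/- For all H_A, H_B > 0 and P_tot > 0, the half-duplex two-way relay SNR function f is strictly concave on the interval [0, P_tot]; that is, for all x₁ ≠ x₂ in [0, P_tot] and all t ∈ (0,1), f(t·x₁ + (1−t)·x₂) > t·f(x₁) + (1−t)·f(x₂). -/
noncomputable def fHD (HA HB Ptot x : ℝ) : ℝ :=
  HA * HB * x * (Ptot - x) / (HA * (Ptot + x) + HB * (Ptot - x) + 2)

/-- The denominator of `fHD` is positive on the feasible interval. -/
lemma fHD_denom_pos {HA HB Ptot x : ℝ} (hHA : 0 < HA) (hHB : 0 < HB)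
    (hx : x ∈ Set.Icc (0 : ℝ) Ptot) :
    0 < HA * (Ptot + x) + HB * (Ptot - x) + 2 := by
  obtain ⟨h0, h1⟩ := hx
  have := mul_nonneg hHA.le (add_nonneg (h0.trans h1) h0)
  have := mul_nonneg hHB.le (sub_nonneg.2 h1)
  linarith

theorem stmt_4 (HA HB Ptot : ℝ) (hHA : 0 < HA) (hHB : 0 < HB) (hP : 0 < Ptot) :
    StrictConcaveOn ℝ (Set.Icc (0 : ℝ) Ptot) (fHD HA HB Ptot) := by
  refine ⟨convex_Icc 0 Ptot, fun x hx y hy hxy a b ha hb hab => ?_⟩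
  have hDx := fHD_denom_pos hHA hHB hx
  have hDy := fHD_denom_pos hHA hHB hy
  have hDz := fHD_denom_pos hHA hHB (convex_Icc 0 Ptot hx hy ha.le hb.le hab)
  obtain rfl : b = 1 - a := by linarith
  simp only [smul_eq_mul, fHD] at hDz ⊢
  rw [← sub_pos]
  have hxy2 : 0 < (x - y) ^ 2 := by
    have := sub_ne_zero.2 hxy
    positivity
  have key : 0 < HA * HB * (a * (1 - a) * (x - y) ^ 2 *
      (((HA + HB) * Ptot + 2) * (2 * HA * Ptot + 2))) /
      ((HA * (Ptot + x) + HB * (Ptot - x) + 2) * (HA * (Ptot + y) + HB * (Ptot - y) + 2) *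
        (HA * (Ptot + (a * x + (1 - a) * y)) + HB * (Ptot - (a * x + (1 - a) * y)) + 2)) := by
    positivity
  refine key.trans_eq (Eq.symm ?_)
  rw [mul_div_assoc', mul_div_assoc', sub_add_eq_sub_sub, div_sub_div _ _ hDz.ne' hDx.ne',
    div_sub_div _ _ (mul_pos hDz hDx).ne' hDy.ne',
    div_eq_div_iff (by positivity) (by positivity)]
  ring
end

section
/- For all H_A, H_B > 0 with H_A ≠ H_B and P_tot > 0, the point P* = −(H_A·P_tot + H_B·P_tot + 2 − √(2·(H_A·P_tot + 1)·(H_A·P_tot + H_B·P_tot + 2)))/(H_A − H_B) lies in the open interval (0, P_tot) and is the unique maximizer of the half-duplex two-way relay SNR function f on [0, P_tot]; that is, f(x) < f(P*) for every x ∈ [0, P_tot] with x ≠ P*. -/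
/-- The SNR gap to a critical point `p` is a positive multiple of `(x - p) ^ 2`. -/
theorem fHD_sub_fHD_of_critical {HA HB P p x : ℝ}
    (hp : HA * (P + p) + HB * (P - p) + 2 ≠ 0) (hx : HA * (P + x) + HB * (P - x) + 2 ≠ 0)
    (hcrit : 2 * (HA * P + HB * P + 2) * p + (HA - HB) * p ^ 2 = (HA * P + HB * P + 2) * P) :
    fHD HA HB P p - fHD HA HB P x =
      HA * HB * (x - p) ^ 2 / (HA * (P + x) + HB * (P - x) + 2) := by
  unfold fHD
  rw [div_sub_div _ _ hp hx, div_eq_div_iff (mul_ne_zero hp hx) hx]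
  linear_combination
    HA * HB * (x - p) * (HA * (P + x) + HB * (P - x) + 2) * hcrit

theorem stmt_5 (HA HB Ptot : ℝ) (hHA : 0 < HA) (hHB : 0 < HB) (hne : HA ≠ HB)
    (hP : 0 < Ptot) :
    -(HA * Ptot + HB * Ptot + 2 -
        Real.sqrt (2 * (HA * Ptot + 1) * (HA * Ptot + HB * Ptot + 2))) / (HA - HB)
      ∈ Set.Ioo (0 : ℝ) Ptot ∧
    ∀ x ∈ Set.Icc (0 : ℝ) Ptot,
      x ≠ -(HA * Ptot + HB * Ptot + 2 -
              Real.sqrt (2 * (HA * Ptot + 1) * (HA * Ptot + HB * Ptot + 2))) / (HA - HB) →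
      fHD HA HB Ptot x <
        fHD HA HB Ptot
          (-(HA * Ptot + HB * Ptot + 2 -
              Real.sqrt (2 * (HA * Ptot + 1) * (HA * Ptot + HB * Ptot + 2))) / (HA - HB)) := by
  have hd : HA - HB ≠ 0 := sub_ne_zero.mpr hne
  have hA : 0 < HA * Ptot := mul_pos hHA hP
  have hB : 0 < HB * Ptot := mul_pos hHB hP
  have hS : 0 < HA * Ptot + HB * Ptot + 2 := by positivity
  have hR2 : 0 < 2 * (HA * Ptot + 1) * (HA * Ptot + HB * Ptot + 2) := by positivity
  have hsq := Real.sq_sqrt hR2.le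
  have hR := Real.sqrt_pos.mpr hR2
  set R := Real.sqrt (2 * (HA * Ptot + 1) * (HA * Ptot + HB * Ptot + 2))
  set p := -(HA * Ptot + HB * Ptot + 2 - R) / (HA - HB) with hp_def
  have hpR : HA * Ptot + HB * Ptot + 2 + (HA - HB) * p = R := by
    rw [hp_def, mul_div_cancel₀ _ hd]
    ring
  clear_value p R
  have hcrit : 2 * (HA * Ptot + HB * Ptot + 2) * p + (HA - HB) * p ^ 2 =
      (HA * Ptot + HB * Ptot + 2) * Ptot := by
    apply mul_left_cancel₀ hd
    rw [← hpR] at hsq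
    linear_combination hsq
  have hp0 : 0 < p := by
    have h : 0 < p * (HA * Ptot + HB * Ptot + 2 + R) := by
      rw [← hpR]
      linarith [mul_pos hS hP]
    exact pos_of_mul_pos_left h (by positivity)
  have hpP : p < Ptot := by
    have h : 0 < (Ptot - p) * (HA * Ptot + HB * Ptot + 2) := by
      have := mul_pos hp0 hR
      rw [← hpR] at this
      linarith
    exact sub_pos.mp (pos_of_mul_pos_left h hS.le)
  refine ⟨⟨hp0, hpP⟩, fun x ⟨hx0, hxP⟩ hxp => ?_⟩
  have hq : 0 < HA * (Ptot + x) + HB * (Ptot - x) + 2 := by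
    have := sub_nonneg.mpr hxP
    positivity
  have hqp : HA * (Ptot + p) + HB * (Ptot - p) + 2 ≠ 0 := by
    have := sub_pos.mpr hpP
    positivity
  rw [← sub_pos, fHD_sub_fHD_of_critical hqp hq.ne' hcrit]
  have := sub_ne_zero.mpr hxp
  positivity
end

section
/- For all m, θ > 0 and every ε ∈ (0, 1/2], the per-rate HD effective-capacity map g is strictly increasing and strictly concave on ℝ; that is, t₁ < t₂ implies g(t₁) < g(t₂), and for all t₁ ≠ t₂ and all λ ∈ (0,1), g(λ·t₁ + (1−λ)·t₂) > λ·g(t₁) + (1−λ)·g(t₂). -/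
noncomputable def gHD (m θ ε t : ℝ) : ℝ :=
  -(1 / (m * θ)) * Real.log (Real.exp (-(t * m * θ / 2)) * (1 - ε) + ε)

theorem gHD_arg_pos {ε : ℝ} (hε0 : 0 < ε) (hε1 : ε < 1) (x : ℝ) :
    0 < Real.exp x * (1 - ε) + ε := by
  have := mul_pos (Real.exp_pos x) (sub_pos.2 hε1)
  linarith

theorem gHD_arg_strictAnti {m θ ε : ℝ} (hm : 0 < m) (hθ : 0 < θ) (hε1 : ε < 1) :
    StrictAnti fun t : ℝ => Real.exp (-(t * m * θ / 2)) * (1 - ε) + ε := by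
  intro s t hst
  have hε : 0 < 1 - ε := sub_pos.2 hε1
  beta_reduce
  gcongr

theorem hasDerivAt_gHD {m θ ε : ℝ} (hm : 0 < m) (hθ : 0 < θ) (hε0 : 0 < ε) (hε1 : ε < 1)
    (t : ℝ) :
    HasDerivAt (gHD m θ ε)
      (1 / 2 - ε / 2 / (Real.exp (-(t * m * θ / 2)) * (1 - ε) + ε)) t := by
  have hpos := gHD_arg_pos hε0 hε1 (-(t * m * θ / 2))
  have hexp : HasDerivAt (fun t : ℝ => -(t * m * θ / 2)) (-(1 * m * θ / 2)) t :=
    ((((hasDerivAt_id t).mul_const m).mul_const θ).div_const 2).neg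
  have h := (((hexp.exp.mul_const (1 - ε)).add_const ε).log hpos.ne').const_mul (-(1 / (m * θ)))
  refine h.congr_deriv ?_
  generalize Real.exp (-(t * m * θ / 2)) = E at hpos ⊢
  have hne := hpos.ne'
  field_simp
  ring

theorem stmt_8 (m θ ε : ℝ) (hm : 0 < m) (hθ : 0 < θ) (hε0 : 0 < ε) (hε1 : ε ≤ 1 / 2) :
    StrictMono (gHD m θ ε) ∧ StrictConcaveOn ℝ Set.univ (gHD m θ ε) := by
  have hε : ε < 1 := by linarith
  have hanti := gHD_arg_strictAnti hm hθ hε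
  have hderiv := hasDerivAt_gHD hm hθ hε0 hε
  constructor
  · intro s t hst
    have hlog := Real.log_lt_log (gHD_arg_pos hε0 hε _) (hanti hst)
    have hc : 0 < 1 / (m * θ) := by positivity
    have := mul_lt_mul_of_pos_left hlog hc
    unfold gHD
    linarith
  · refine StrictAnti.strictConcaveOn_univ_of_deriv
      (continuous_iff_continuousAt.2 fun t => (hderiv t).continuousAt) ?_
    intro s t hst
    rw [(hderiv s).deriv, (hderiv t).deriv]
    exact sub_lt_sub_left
      (div_lt_div_of_pos_left (half_pos hε0) (gHD_arg_pos hε0 hε _) (hanti hst)) _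
end

section
/- Let m, θ > 0, ε ∈ (0, 1/2], n ≥ 1, and let p₁, …, p_n > 0 with p₁ + ⋯ + p_n = 1. Then the function Φ : ℝⁿ → ℝ defined by Φ(t₁, …, t_n) = −(1/(mθ))·log(Σ_{j=1}^n p_j·(e^{−t_j·m·θ/2}·(1 − ε) + ε)) is concave on ℝⁿ and is strictly increasing in each coordinate (i.e., strictly increasing in t_k when the other coordinates are held fixed, for each k). -/
/-- The weighted log-sum-exp function is convex. -/
theorem log_sum_mul_exp_convex {ι : Type*} [Fintype ι] [Nonempty ι] (w x y : ι → ℝ)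
    (hw : ∀ i, 0 < w i) {a b : ℝ} (ha : 0 ≤ a) (hb : 0 ≤ b) (hab : a + b = 1) :
    Real.log (∑ i, w i * Real.exp (a * x i + b * y i)) ≤
      a * Real.log (∑ i, w i * Real.exp (x i)) + b * Real.log (∑ i, w i * Real.exp (y i)) := by
  have hpos : ∀ z : ι → ℝ, 0 < ∑ i, w i * Real.exp (z i) := fun z =>
    Finset.sum_pos (fun i _ => mul_pos (hw i) (Real.exp_pos _)) Finset.univ_nonempty
  have hnorm : ∀ z : ι → ℝ,
      ∑ i, w i * Real.exp (z i - Real.log (∑ i, w i * Real.exp (z i))) = 1 := by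
    intro z
    simp_rw [Real.exp_sub, Real.exp_log (hpos z), ← mul_div_assoc]
    rw [← Finset.sum_div, div_self (hpos z).ne']
  have hx := hnorm x
  have hy := hnorm y
  rw [Real.log_le_iff_le_exp (hpos _)]
  set X := Real.log (∑ i, w i * Real.exp (x i))
  set Y := Real.log (∑ i, w i * Real.exp (y i))
  have hterm : ∀ i, w i * Real.exp (a * x i + b * y i) ≤
      Real.exp (a * X + b * Y) *
        (a * (w i * Real.exp (x i - X)) + b * (w i * Real.exp (y i - Y))) := by
    intro i
    have h := convexOn_exp.2 (Set.mem_univ (x i - X)) (Set.mem_univ (y i - Y)) ha hb hab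
    simp only [smul_eq_mul] at h
    calc w i * Real.exp (a * x i + b * y i)
        = w i * Real.exp (a * X + b * Y) * Real.exp (a * (x i - X) + b * (y i - Y)) := by
          rw [mul_assoc, ← Real.exp_add]; ring_nf
      _ ≤ w i * Real.exp (a * X + b * Y) *
            (a * Real.exp (x i - X) + b * Real.exp (y i - Y)) :=
          mul_le_mul_of_nonneg_left h (mul_pos (hw i) (Real.exp_pos _)).le
      _ = _ := by ring
  refine (Finset.sum_le_sum fun i _ => hterm i).trans_eq ?_
  rw [← Finset.mul_sum, Finset.sum_add_distrib, ← Finset.mul_sum, ← Finset.mul_sum, hx, hy]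
  linear_combination Real.exp (a * X + b * Y) * hab


theorem stmt_9 (m θ ε : ℝ) (hm : 0 < m) (hθ : 0 < θ) (hε0 : 0 < ε) (hε1 : ε ≤ 1 / 2)
    (n : ℕ) (hn : 1 ≤ n) (p : Fin n → ℝ) (hp : ∀ j, 0 < p j) (hsum : ∑ j, p j = 1) :
    ConcaveOn ℝ Set.univ
      (fun t : Fin n → ℝ =>
        -(1 / (m * θ)) *
          Real.log (∑ j, p j * (Real.exp (-(t j * m * θ / 2)) * (1 - ε) + ε))) ∧
    ∀ (k : Fin n) (t : Fin n → ℝ) (s₁ s₂ : ℝ), s₁ < s₂ →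
      (fun t : Fin n → ℝ =>
        -(1 / (m * θ)) *
          Real.log (∑ j, p j * (Real.exp (-(t j * m * θ / 2)) * (1 - ε) + ε)))
        (Function.update t k s₁) <
      (fun t : Fin n → ℝ =>
        -(1 / (m * θ)) *
          Real.log (∑ j, p j * (Real.exp (-(t j * m * θ / 2)) * (1 - ε) + ε)))
        (Function.update t k s₂) := by
  have hmθ : 0 < m * θ := mul_pos hm hθ
  have hc : 0 < 1 / (m * θ) := one_div_pos.mpr hmθ
  have hε : 0 < 1 - ε := by linarith
  have : Nonempty (Fin n) := ⟨⟨0, hn⟩⟩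
  have hpos : ∀ t : Fin n → ℝ,
      0 < ∑ j, p j * (Real.exp (-(t j * m * θ / 2)) * (1 - ε) + ε) := fun t =>
    Finset.sum_pos (fun j _ => mul_pos (hp j) (by positivity)) Finset.univ_nonempty
  constructor
  · let w : Option (Fin n) → ℝ := fun o => o.elim ε fun j => p j * (1 - ε)
    let e : (Fin n → ℝ) → Option (Fin n) → ℝ := fun t o => o.elim 0 fun j => -(t j * m * θ / 2)
    have hw : ∀ o, 0 < w o := by
      rintro (_ | j)
      · exact hε0
      · exact mul_pos (hp j) hε
    have hrepr : ∀ t : Fin n → ℝ,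
        ∑ j, p j * (Real.exp (-(t j * m * θ / 2)) * (1 - ε) + ε) =
          ∑ o, w o * Real.exp (e t o) := by
      intro t
      simp only [Fintype.sum_option, w, e, Option.elim, Real.exp_zero, mul_add,
        Finset.sum_add_distrib, ← Finset.sum_mul, hsum]
      rw [add_comm, one_mul, mul_one]
      congr 1
      exact Finset.sum_congr rfl fun j _ => by ring
    refine ⟨convex_univ, fun x _ y _ a b ha hb hab => ?_⟩
    have key := log_sum_mul_exp_convex w (e x) (e y) hw ha hb hab
    have he : ∀ o, a * e x o + b * e y o = e (a • x + b • y) o := by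
      rintro (_ | j)
      · simp [e]
      · simp only [e, Option.elim, Pi.add_apply, Pi.smul_apply, smul_eq_mul]
        ring
    simp only [he, ← hrepr] at key
    have := mul_le_mul_of_nonneg_left key hc.le
    simp only [smul_eq_mul] at this ⊢
    linarith
  · intro k t s₁ s₂ hs
    refine mul_lt_mul_of_neg_left (Real.log_lt_log (hpos _) ?_) (neg_neg_of_pos hc)
    refine Finset.sum_lt_sum (fun j _ => ?_) ⟨k, Finset.mem_univ k, ?_⟩
    · rcases eq_or_ne j k with rfl | hj
      · have hpj := (hp j).le
        simp only [Function.update_self]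
        gcongr
      · simp [hj]
    · have hpk := hp k
      simp only [Function.update_self]
      gcongr
end

section
/- Let H_A, H_B > 0, P_tot > 0, m ≥ 100, 0 ≤ q ≤ 9.9, θ > 0 and ε ∈ (0, 1/2]. Then the composite map x ↦ g(r_{m,q}(f(x))) is concave on the set I = {x ∈ (0, P_tot) : f(x) > 1} (which is an interval, being a superlevel set of the strictly concave function f). -/
/-- Composition of a concave nondecreasing function on `t` with a concave map from `s` to `t`. -/
theorem ConcaveOn.comp_mapsTo {g f : ℝ → ℝ} {s t : Set ℝ} (hg : ConcaveOn ℝ t g)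
    (hmono : MonotoneOn g t) (hf : ConcaveOn ℝ s f) (hst : Set.MapsTo f s t) :
    ConcaveOn ℝ s (fun x => g (f x)) := by
  refine ⟨hf.1, fun x hx y hy a b ha hb hab => ?_⟩
  exact (hg.2 (hst hx) (hst hy) ha hb hab).trans
    (hmono (hg.1 (hst hx) (hst hy) ha hb hab) (hst (hf.1 hx hy ha hb hab))
      (hf.2 hx hy ha hb hab))

theorem fHD_concaveOn {HA HB Ptot : ℝ} (hHA : 0 < HA) (hHB : 0 < HB) (hP : 0 < Ptot) :
    ConcaveOn ℝ (Set.Ioo 0 Ptot) (fHD HA HB Ptot) := by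
  have hD : ∀ x ∈ Set.Ioo 0 Ptot, 0 < HA * (Ptot + x) + HB * (Ptot - x) + 2 := by
    rintro x ⟨h0, h1⟩
    have := mul_pos hHA (add_pos hP h0)
    have := mul_pos hHB (sub_pos.2 h1)
    linarith
  refine ⟨convex_Ioo 0 Ptot, fun x hx y hy a b ha hb hab => ?_⟩
  have hz := hD _ (convex_Ioo 0 Ptot hx hy ha hb hab)
  have hx' := hD x hx
  have hy' := hD y hy
  obtain rfl : a = 1 - b := by linarith
  simp only [smul_eq_mul] at hz ⊢
  rw [← sub_nonneg]
  have key : fHD HA HB Ptot ((1 - b) * x + b * y)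
      - ((1 - b) * fHD HA HB Ptot x + b * fHD HA HB Ptot y)
      = HA * HB * ((1 - b) * b * (x - y) ^ 2
          * (((HA + HB) * Ptot + 2) * (2 * HA * Ptot + 2)))
        / ((HA * (Ptot + x) + HB * (Ptot - x) + 2) * (HA * (Ptot + y) + HB * (Ptot - y) + 2)
          * (HA * (Ptot + ((1 - b) * x + b * y)) + HB * (Ptot - ((1 - b) * x + b * y)) + 2)) := by
    unfold fHD
    rw [eq_div_iff (by positivity)]
    field_simp
    ring
  rw [key]
  positivity

theorem gHD_monotone {m θ ε : ℝ} (hm : 0 < m) (hθ : 0 < θ) (hε0 : 0 < ε) (hε1 : ε ≤ 1) :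
    Monotone (gHD m θ ε) := by
  intro t u htu
  have h1 : 0 ≤ 1 - ε := by linarith
  unfold gHD
  rw [neg_mul, neg_mul, neg_le_neg_iff]
  gcongr

theorem gHD_hasDerivAt {m θ ε : ℝ} (hm : 0 < m) (hθ : 0 < θ) (hε0 : 0 < ε) (hε1 : ε ≤ 1)
    (t : ℝ) :
    HasDerivAt (gHD m θ ε)
      (1 / 2 - ε / (2 * (Real.exp (-(t * m * θ / 2)) * (1 - ε) + ε))) t := by
  have h1 : 0 ≤ 1 - ε := by linarith
  have hpos : 0 < Real.exp (-(t * m * θ / 2)) * (1 - ε) + ε := by positivity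
  have hlin : HasDerivAt (fun t : ℝ => -(t * m * θ / 2)) (-(1 * m * θ / 2)) t :=
    ((((hasDerivAt_id t).mul_const m).mul_const θ).div_const 2).neg
  have h := (((hlin.exp.mul_const (1 - ε)).add_const ε).log hpos.ne').const_mul (-(1 / (m * θ)))
  refine h.congr_deriv ?_
  field_simp
  ring

theorem gHD_concaveOn {m θ ε : ℝ} (hm : 0 < m) (hθ : 0 < θ) (hε0 : 0 < ε) (hε1 : ε ≤ 1) :
    ConcaveOn ℝ Set.univ (gHD m θ ε) := by
  have h1 : 0 ≤ 1 - ε := by linarith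
  refine Antitone.concaveOn_univ_of_deriv
    (fun t => (gHD_hasDerivAt hm hθ hε0 hε1 t).differentiableAt) ?_
  intro t u htu
  rw [(gHD_hasDerivAt hm hθ hε0 hε1 t).deriv, (gHD_hasDerivAt hm hθ hε0 hε1 u).deriv]
  gcongr

theorem rFBL_eq (m q γ : ℝ) :
    rFBL m q γ = 1 / Real.log 2 * (Real.log (1 + γ)
      - q / Real.sqrt m * (Real.sqrt (γ * (γ + 2)) / (γ + 1))) + Real.logb 2 m / m := by
  unfold rFBL
  simp only [Real.logb, Real.log_exp]
  rw [div_mul_eq_div_div]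
  ring

theorem hasDerivAt_log_sub_dispersion (c : ℝ) {γ : ℝ} (hγ : 0 < γ) :
    HasDerivAt (fun γ => Real.log (1 + γ) - c * (Real.sqrt (γ * (γ + 2)) / (γ + 1)))
      (1 / (1 + γ) - c * (1 / ((γ + 1) ^ 2 * Real.sqrt (γ * (γ + 2))))) γ := by
  have hp : 0 < γ * (γ + 2) := by positivity
  have hs : 0 < Real.sqrt (γ * (γ + 2)) := Real.sqrt_pos.2 hp
  have hsq : Real.sqrt (γ * (γ + 2)) ^ 2 = γ * (γ + 2) := Real.sq_sqrt hp.le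
  have hw : HasDerivAt (fun γ : ℝ => Real.sqrt (γ * (γ + 2))) _ γ :=
    ((hasDerivAt_id γ).mul ((hasDerivAt_id γ).add_const 2)).sqrt hp.ne'
  have hl : HasDerivAt (fun γ : ℝ => Real.log (1 + γ)) _ γ :=
    ((hasDerivAt_id γ).const_add 1).log (by simp only [id]; positivity)
  have hd : HasDerivAt (fun γ : ℝ => γ + 1) 1 γ := (hasDerivAt_id γ).add_const 1
  refine (hl.sub ((hw.div hd (by positivity)).const_mul c)).congr_deriv ?_
  simp only [id, Pi.mul_apply]
  congr 2
  field_simp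
  rw [hsq]
  ring

theorem hasDerivAt_deriv_log_sub_dispersion (c : ℝ) {γ : ℝ} (hγ : 0 < γ) :
    HasDerivAt (fun γ => 1 / (1 + γ) - c * (1 / ((γ + 1) ^ 2 * Real.sqrt (γ * (γ + 2)))))
      (-1 / (1 + γ) ^ 2
        + c * ((3 * (γ * (γ + 2)) + 1) / ((γ + 1) ^ 3 * Real.sqrt (γ * (γ + 2)) ^ 3))) γ := by
  have hp : 0 < γ * (γ + 2) := by positivity
  have hs : 0 < Real.sqrt (γ * (γ + 2)) := Real.sqrt_pos.2 hp
  have hsq : Real.sqrt (γ * (γ + 2)) ^ 2 = γ * (γ + 2) := Real.sq_sqrt hp.le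
  have hw : HasDerivAt (fun γ : ℝ => Real.sqrt (γ * (γ + 2))) _ γ :=
    ((hasDerivAt_id γ).mul ((hasDerivAt_id γ).add_const 2)).sqrt hp.ne'
  have hl : HasDerivAt (fun γ : ℝ => 1 / (1 + γ)) _ γ :=
    (hasDerivAt_const γ (1 : ℝ)).div ((hasDerivAt_id γ).const_add 1)
      (by positivity)
  have hd : HasDerivAt (fun γ : ℝ => (γ + 1) ^ 2) _ γ := ((hasDerivAt_id γ).add_const 1).pow 2
  have hv : HasDerivAt (fun γ : ℝ => 1 / ((γ + 1) ^ 2 * Real.sqrt (γ * (γ + 2)))) _ γ :=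
    (hasDerivAt_const γ (1 : ℝ)).div (hd.mul hw) (by positivity)
  refine (hl.sub (hv.const_mul c)).congr_deriv ?_
  simp only [id, Pi.mul_apply]
  rw [sub_eq_add_neg, ← mul_neg]
  congr 2
  · simp
  · field_simp
    rw [hsq]
    ring

theorem sqrt_three_le_sqrt_mul {γ : ℝ} (hγ : 1 ≤ γ) : 1.73 ≤ Real.sqrt (γ * (γ + 2)) :=
  Real.le_sqrt_of_sq_le (by nlinarith)

theorem monotoneOn_log_sub_dispersion {c : ℝ} (hc1 : c ≤ 1) :
    MonotoneOn (fun γ => Real.log (1 + γ) - c * (Real.sqrt (γ * (γ + 2)) / (γ + 1)))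
      (Set.Ici 1) := by
  refine monotoneOn_of_hasDerivWithinAt_nonneg (convex_Ici 1)
    (fun γ hγ => (hasDerivAt_log_sub_dispersion c
      (zero_lt_one.trans_le hγ)).continuousAt.continuousWithinAt)
    (fun γ hγ => (hasDerivAt_log_sub_dispersion c
      (zero_lt_one.trans_le (interior_subset hγ))).hasDerivWithinAt) ?_
  intro γ hγ
  have hγ1 : 1 ≤ γ := interior_subset hγ
  have hw := sqrt_three_le_sqrt_mul hγ1
  have hw0 : 0 < Real.sqrt (γ * (γ + 2)) := by linarith
  have h : 1 / (1 + γ) - c * (1 / ((γ + 1) ^ 2 * Real.sqrt (γ * (γ + 2))))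
      = ((γ + 1) * Real.sqrt (γ * (γ + 2)) - c)
        / ((γ + 1) ^ 2 * Real.sqrt (γ * (γ + 2))) := by
    field_simp
    ring
  rw [h]
  refine div_nonneg ?_ (by positivity)
  nlinarith

theorem concaveOn_log_sub_dispersion {c : ℝ} (hc1 : c ≤ 1) :
    ConcaveOn ℝ (Set.Ici 1)
      (fun γ => Real.log (1 + γ) - c * (Real.sqrt (γ * (γ + 2)) / (γ + 1))) := by
  refine concaveOn_of_hasDerivWithinAt2_nonpos (convex_Ici 1)
    (fun γ hγ => (hasDerivAt_log_sub_dispersion c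
      (zero_lt_one.trans_le hγ)).continuousAt.continuousWithinAt)
    (fun γ hγ => (hasDerivAt_log_sub_dispersion c
      (zero_lt_one.trans_le (interior_subset hγ))).hasDerivWithinAt)
    (fun γ hγ => (hasDerivAt_deriv_log_sub_dispersion c
      (zero_lt_one.trans_le (interior_subset hγ))).hasDerivWithinAt) ?_
  intro γ hγ
  have hγ1 : 1 ≤ γ := interior_subset hγ
  have hw := sqrt_three_le_sqrt_mul hγ1
  have hw0 : 0 < Real.sqrt (γ * (γ + 2)) := by linarith
  have hsq : Real.sqrt (γ * (γ + 2)) ^ 2 = γ * (γ + 2) := Real.sq_sqrt (by positivity)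
  have hp : 3 ≤ γ * (γ + 2) := by nlinarith
  generalize Real.sqrt (γ * (γ + 2)) = w at hw hw0 hsq ⊢
  rw [← hsq] at hp ⊢
  have h : -1 / (1 + γ) ^ 2 + c * ((3 * w ^ 2 + 1) / ((γ + 1) ^ 3 * w ^ 3))
      = (c * (3 * w ^ 2 + 1) - (γ + 1) * w * w ^ 2) / ((γ + 1) ^ 3 * w ^ 3) := by
    field_simp
    ring
  rw [h]
  refine div_nonpos_of_nonpos_of_nonneg ?_ (by positivity)
  have hcw : c * (3 * w ^ 2 + 1) ≤ 1 * (3 * w ^ 2 + 1) := by gcongr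
  have hgw : 3.46 ≤ (γ + 1) * w := by nlinarith
  have hgw2 : 3.46 * w ^ 2 ≤ (γ + 1) * w * w ^ 2 := by gcongr
  linarith

theorem div_sqrt_le_one {m q : ℝ} (hm : 100 ≤ m) (hq1 : q ≤ 9.9) : q / Real.sqrt m ≤ 1 := by
  have h : 10 ≤ Real.sqrt m := Real.le_sqrt_of_sq_le (by linarith)
  rw [div_le_one (by linarith)]
  linarith

theorem rFBL_monotoneOn {m q : ℝ} (hm : 100 ≤ m) (hq1 : q ≤ 9.9) :
    MonotoneOn (rFBL m q) (Set.Ici 1) := by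
  intro x hx y hy hxy
  have h := monotoneOn_log_sub_dispersion (div_sqrt_le_one hm hq1) hx hy hxy
  have h2 : 0 < Real.log 2 := Real.log_pos one_lt_two
  rw [rFBL_eq, rFBL_eq]
  dsimp only at h
  gcongr

theorem rFBL_concaveOn {m q : ℝ} (hm : 100 ≤ m) (hq1 : q ≤ 9.9) :
    ConcaveOn ℝ (Set.Ici 1) (rFBL m q) := by
  have h2 : 0 ≤ 1 / Real.log 2 := (one_div_pos.2 (Real.log_pos one_lt_two)).le
  have h := ((concaveOn_log_sub_dispersion (div_sqrt_le_one hm hq1)).smul h2).add_const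
    (Real.logb 2 m / m)
  rw [funext (rFBL_eq m q)]
  exact h

theorem stmt_10 (HA HB Ptot m q θ ε : ℝ) (hHA : 0 < HA) (hHB : 0 < HB) (hP : 0 < Ptot)
    (hm : 100 ≤ m) (hq0 : 0 ≤ q) (hq1 : q ≤ 9.9) (hθ : 0 < θ)
    (hε0 : 0 < ε) (hε1 : ε ≤ 1 / 2) :
    ConcaveOn ℝ {x : ℝ | x ∈ Set.Ioo (0 : ℝ) Ptot ∧ 1 < fHD HA HB Ptot x}
      (fun x => gHD m θ ε (rFBL m q (fHD HA HB Ptot x))) := by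
  have hm0 : 0 < m := by linarith
  have hε : ε ≤ 1 := by linarith
  have hf := fHD_concaveOn hHA hHB hP
  have hfI := hf.subset (fun x hx => hx.1) (hf.convex_gt 1)
  have hr := (rFBL_concaveOn hm hq1).comp_mapsTo (rFBL_monotoneOn hm hq1) hfI
    (fun x hx => le_of_lt hx.2)
  exact (gHD_concaveOn hm0 hθ hε0 hε).comp_mapsTo
    ((gHD_monotone hm0 hθ hε0 hε).monotoneOn _) hr (Set.mapsTo_univ _ _)
end

section
/- Let H_A, H_B > 0 with H_A ≠ H_B, P_tot > 0, m ≥ 100, 0 ≤ q ≤ 9.9, θ > 0 and ε ∈ (0, 1/2], and let P* = −(H_A·P_tot + H_B·P_tot + 2 − √(2·(H_A·P_tot + 1)·(H_A·P_tot + H_B·P_tot + 2)))/(H_A − H_B). If f(P*) > 1, then for every x ∈ [0, P_tot] with x ≠ P* and f(x) > 1 one has g(r_{m,q}(f(x))) < g(r_{m,q}(f(P*))); i.e., the effective capacity x ↦ g(r_{m,q}(f(x))) attains its maximum over {x ∈ [0, P_tot] : f(x) > 1} uniquely at P*. -/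
/-- For `γ ≥ 1` the square root in the channel-dispersion term is at least half its denominator. -/
theorem half_le_sqrt_dispersion {γ : ℝ} (hγ : 1 ≤ γ) :
    1 / 2 ≤ Real.sqrt (γ * (γ + 2)) / (γ + 1) := by
  rw [le_div_iff₀ (by linarith)]
  apply Real.le_sqrt_of_sq_le
  nlinarith

theorem sqrt_dispersion_sub_lt_log {γ δ : ℝ} (hγ : 1 ≤ γ) (h : γ < δ) {c : ℝ} (hc0 : 0 ≤ c)
    (hc1 : c < 1) :
    c * (Real.sqrt (δ * (δ + 2)) / (δ + 1) - Real.sqrt (γ * (γ + 2)) / (γ + 1)) <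
      Real.log (1 + δ) - Real.log (1 + γ) := by
  have hγ1 : 0 < 1 + γ := by linarith
  have hδ1 : 0 < 1 + δ := by linarith
  have hsq : ∀ y : ℝ, 1 ≤ y →
      (Real.sqrt (y * (y + 2)) / (y + 1)) ^ 2 = 1 - (1 / (1 + y)) ^ 2 := by
    intro y hy
    rw [div_pow, Real.sq_sqrt (by nlinarith)]
    field_simp
    ring
  have hA := hsq γ hγ
  have hB := hsq δ (by linarith)
  have hA2 := half_le_sqrt_dispersion hγ
  have hB2 := half_le_sqrt_dispersion (hγ.trans h.le)
  set A := Real.sqrt (γ * (γ + 2)) / (γ + 1)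
  set B := Real.sqrt (δ * (δ + 2)) / (δ + 1)
  have hlog : 1 - (1 + γ) / (1 + δ) ≤ Real.log (1 + δ) - Real.log (1 + γ) := by
    rw [← Real.log_div hδ1.ne' hγ1.ne']
    simpa using Real.one_sub_inv_le_log_of_pos (div_pos hδ1 hγ1)
  have hw : (1 + γ) / (1 + δ) < 1 := by rw [div_lt_one hδ1]; linarith
  have hw0 : 0 < (1 + γ) / (1 + δ) := div_pos hγ1 hδ1
  have hu : 1 / (1 + γ) ≤ 1 / 2 := one_div_le_one_div_of_le (by norm_num) (by linarith)
  have hu0 : 0 < 1 / (1 + γ) := by positivity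
  have hv : 1 / (1 + δ) = 1 / (1 + γ) * ((1 + γ) / (1 + δ)) := by field_simp
  rw [hv] at hB
  set w := (1 + γ) / (1 + δ)
  set u := 1 / (1 + γ)
  have hfac : (B - A) * (B + A) = u ^ 2 * ((1 - w) * (1 + w)) := by linear_combination hB - hA
  have hu2 : u ^ 2 ≤ 1 / 4 := by nlinarith
  have hpos : 0 < (1 - w) * (1 + w) := mul_pos (by linarith) (by linarith)
  have hBA0 : 0 < B - A := by
    by_contra! hcon
    have : 0 < u ^ 2 * ((1 - w) * (1 + w)) := by positivity
    nlinarith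
  have hBA : B - A ≤ 1 - w := by
    have h1 : u ^ 2 * ((1 - w) * (1 + w)) ≤ 1 / 4 * ((1 - w) * (1 + w)) :=
      mul_le_mul_of_nonneg_right hu2 hpos.le
    nlinarith
  nlinarith

theorem rFBL_strictMonoOn {m q : ℝ} (hm : 100 ≤ m) (hq0 : 0 ≤ q) (hq1 : q ≤ 9.9) :
    StrictMonoOn (rFBL m q) (Set.Ici 1) := by
  intro γ hγ δ _ h
  have hs : 10 ≤ Real.sqrt m := Real.le_sqrt_of_sq_le (by linarith)
  have hs0 : 0 < Real.sqrt m := by linarith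
  have key := sqrt_dispersion_sub_lt_log hγ h (c := q / Real.sqrt m) (by positivity)
    (by rw [div_lt_one hs0]; norm_num at hq1; linarith)
  have hform : ∀ y : ℝ, rFBL m q y = (Real.log (1 + y) -
      q / Real.sqrt m * (Real.sqrt (y * (y + 2)) / (y + 1))) / Real.log 2 +
      Real.logb 2 m / m := by
    intro y
    simp only [rFBL, Real.logb, Real.log_exp, div_eq_mul_inv, mul_inv]
    ring
  rw [hform, hform]
  gcongr ?_ / _ + _
  linarith

theorem gHD_strictMono {m θ ε : ℝ} (hm : 0 < m) (hθ : 0 < θ) (hε0 : 0 < ε) (hε1 : ε < 1) :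
    StrictMono (gHD m θ ε) := by
  intro s t hst
  have hε : 0 < 1 - ε := by linarith
  have hlog : Real.log (Real.exp (-(t * m * θ / 2)) * (1 - ε) + ε) <
      Real.log (Real.exp (-(s * m * θ / 2)) * (1 - ε) + ε) := by
    apply Real.log_lt_log (by positivity)
    gcongr
  have : 0 < 1 / (m * θ) := by positivity
  unfold gHD
  nlinarith

theorem fHD_lt_of_ne {HA HB P p x : ℝ} (hHA : 0 < HA) (hHB : 0 < HB) (hne : HA ≠ HB) (hP : 0 < P)
    (hp : p = -(HA * P + HB * P + 2 -
        Real.sqrt (2 * (HA * P + 1) * (HA * P + HB * P + 2))) / (HA - HB))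
    (hx : x ∈ Set.Icc (0 : ℝ) P) (hxp : x ≠ p) :
    fHD HA HB P x < fHD HA HB P p := by
  obtain ⟨hx0, hx1⟩ := hx
  have hd : HA - HB ≠ 0 := sub_ne_zero.mpr hne
  have hss := Real.sq_sqrt (show 0 ≤ 2 * (HA * P + 1) * (HA * P + HB * P + 2) by positivity)
  have hs0 : 0 < Real.sqrt (2 * (HA * P + 1) * (HA * P + HB * P + 2)) :=
    Real.sqrt_pos.mpr (by positivity)
  set s := Real.sqrt (2 * (HA * P + 1) * (HA * P + HB * P + 2))
  have hps : HA * (P + p) + HB * (P - p) + 2 = s := by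
    have : p * (HA - HB) = -(HA * P + HB * P + 2 - s) := by rw [hp]; field_simp
    linear_combination this
  have hD : 0 < HA * (P + x) + HB * (P - x) + 2 := by
    have := mul_nonneg hHB.le (sub_nonneg.mpr hx1)
    positivity
  -- both SNR values have the form `K - c * (D + s ^ 2 / D)` in their denominators `D`
  have hform : ∀ y : ℝ, HA * (P + y) + HB * (P - y) + 2 ≠ 0 →
      fHD HA HB P y = HA * HB / (HA - HB) ^ 2 * (3 * HA * P + HB * P + 4 -
        (HA * (P + y) + HB * (P - y) + 2) - s ^ 2 / (HA * (P + y) + HB * (P - y) + 2)) := by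
    intro y hy
    rw [hss, fHD]
    field_simp
    ring
  rw [hform x hD.ne', hform p (hps ▸ hs0.ne'), hps]
  have hDs : HA * (P + x) + HB * (P - x) + 2 - s ≠ 0 := by
    have : HA * (P + x) + HB * (P - x) + 2 - s = (HA - HB) * (x - p) := by
      linear_combination hps
    rw [this]
    exact mul_ne_zero hd (sub_ne_zero.mpr hxp)
  set D := HA * (P + x) + HB * (P - x) + 2
  have hgap : 0 < (D + s ^ 2 / D) - (s + s ^ 2 / s) := by
    have : (D + s ^ 2 / D) - (s + s ^ 2 / s) = (D - s) ^ 2 / D := by field_simp; ring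
    rw [this]
    positivity
  apply mul_lt_mul_of_pos_left _ (by positivity)
  linarith

theorem stmt_11 (HA HB Ptot m q θ ε : ℝ) (hHA : 0 < HA) (hHB : 0 < HB) (hne : HA ≠ HB)
    (hP : 0 < Ptot) (hm : 100 ≤ m) (hq0 : 0 ≤ q) (hq1 : q ≤ 9.9) (hθ : 0 < θ)
    (hε0 : 0 < ε) (hε1 : ε ≤ 1 / 2)
    (Pstar : ℝ)
    (hPstar : Pstar = -(HA * Ptot + HB * Ptot + 2 -
        Real.sqrt (2 * (HA * Ptot + 1) * (HA * Ptot + HB * Ptot + 2))) / (HA - HB))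
    (hgt : 1 < fHD HA HB Ptot Pstar) :
    ∀ x ∈ Set.Icc (0 : ℝ) Ptot, x ≠ Pstar → 1 < fHD HA HB Ptot x →
      gHD m θ ε (rFBL m q (fHD HA HB Ptot x)) <
        gHD m θ ε (rFBL m q (fHD HA HB Ptot Pstar)) := by
  intro x hx hxp hx1
  exact gHD_strictMono (by linarith) hθ hε0 (by linarith)
    (rFBL_strictMonoOn hm hq0 hq1 hx1.le hgt.le
      (fHD_lt_of_ne hHA hHB hne hP hPstar hx hxp))
end

section
/- Let H_A, H_B > 0 and P_tot > 0, and let M = sup{f(x) : x ∈ [0, P_tot]} be the maximum of the half-duplex two-way relay SNR function f on [0, P_tot]. Then for every threshold c with 0 < c < M, the equation f(x) = c has exactly two solutions in the open interval (0, P_tot). -/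
lemma continuousOn_fHD {HA HB Ptot : ℝ} (hHA : 0 < HA) (hHB : 0 < HB) :
    ContinuousOn (fHD HA HB Ptot) (Set.Icc 0 Ptot) := by
  unfold fHD
  exact ContinuousOn.div (by fun_prop) (by fun_prop)
    fun x hx => (fHD_denom_pos hHA hHB hx).ne'

/-- Vieta's formula for the sum of two distinct points of a level set of `fHD`. -/
lemma fHD_level_sum {HA HB Ptot c x y : ℝ} (hHA : 0 < HA) (hHB : 0 < HB)
    (hx : x ∈ Set.Icc (0 : ℝ) Ptot) (hy : y ∈ Set.Icc (0 : ℝ) Ptot) (hxy : x ≠ y)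
    (hfx : fHD HA HB Ptot x = c) (hfy : fHD HA HB Ptot y = c) :
    HA * HB * (Ptot - x - y) = c * (HA - HB) := by
  rw [fHD, div_eq_iff (fHD_denom_pos hHA hHB hx).ne'] at hfx
  rw [fHD, div_eq_iff (fHD_denom_pos hHA hHB hy).ne'] at hfy
  apply mul_left_cancel₀ (sub_ne_zero.mpr hxy)
  linear_combination hfx - hfy

theorem stmt_13 (HA HB Ptot : ℝ) (hHA : 0 < HA) (hHB : 0 < HB) (hP : 0 < Ptot)
    (c : ℝ) (hc0 : 0 < c)
    (hcM : c < sSup (fHD HA HB Ptot '' Set.Icc (0 : ℝ) Ptot)) :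
    ∃ x₁ ∈ Set.Ioo (0 : ℝ) Ptot, ∃ x₂ ∈ Set.Ioo (0 : ℝ) Ptot,
      x₁ ≠ x₂ ∧ fHD HA HB Ptot x₁ = c ∧ fHD HA HB Ptot x₂ = c ∧
      ∀ x ∈ Set.Ioo (0 : ℝ) Ptot, fHD HA HB Ptot x = c → x = x₁ ∨ x = x₂ := by
  obtain ⟨_, ⟨y, hy, rfl⟩, hcy⟩ :=
    exists_lt_of_lt_csSup ((Set.nonempty_Icc.mpr hP.le).image _) hcM
  have hf := continuousOn_fHD (Ptot := Ptot) hHA hHB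
  have hf₀ : fHD HA HB Ptot 0 = 0 := by simp [fHD]
  have hfP : fHD HA HB Ptot Ptot = 0 := by simp [fHD]
  obtain ⟨x₁, hx₁, hfx₁⟩ := intermediate_value_Ioo hy.1
    (hf.mono (Set.Icc_subset_Icc_right hy.2)) ⟨hf₀.trans_lt hc0, hcy⟩
  obtain ⟨x₂, hx₂, hfx₂⟩ := intermediate_value_Ioo' hy.2
    (hf.mono (Set.Icc_subset_Icc_left hy.1)) ⟨hfP.trans_lt hc0, hcy⟩
  have hx₁P : x₁ ∈ Set.Ioo 0 Ptot := ⟨hx₁.1, hx₁.2.trans_le hy.2⟩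
  have hx₂P : x₂ ∈ Set.Ioo 0 Ptot := ⟨hy.1.trans_lt hx₂.1, hx₂.2⟩
  have hne : x₁ ≠ x₂ := (hx₁.2.trans hx₂.1).ne
  refine ⟨x₁, hx₁P, x₂, hx₂P, hne, hfx₁, hfx₂, fun x hx hfx => ?_⟩
  refine or_iff_not_imp_left.mpr fun hxx₁ => ?_
  have h₁ := fHD_level_sum hHA hHB (Set.Ioo_subset_Icc_self hx)
    (Set.Ioo_subset_Icc_self hx₁P) hxx₁ hfx hfx₁
  have h₂ := fHD_level_sum hHA hHB (Set.Ioo_subset_Icc_self hx₁P)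
    (Set.Ioo_subset_Icc_self hx₂P) hne hfx₁ hfx₂
  apply mul_left_cancel₀ (mul_pos hHA hHB).ne'
  linear_combination h₂ - h₁
end

section
/- For all H_A, H_B > 0, P_tot > 0 and Ω ≥ 0, the full-duplex two-way relay SINR function γ attains its maximum over [0, P_tot] at a unique point x*, and this unique maximizer lies in the open interval (0, P_tot). -/
noncomputable def gammaFD (HA HB Ptot Ω x : ℝ) : ℝ :=
  ((Ptot - x) / 2) * x * HA * HB /
    (x ^ 2 * HA * Ω + x * HA +
      (((Ptot - x) / 2) * Ω + 1) *
        (((Ptot - x) / 2) * HA + ((Ptot - x) / 2) * HB + x * Ω + 1))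

/-- The denominator of `gammaFD`. -/
noncomputable def gammaFDDenom (HA HB Ptot Ω x : ℝ) : ℝ :=
  x ^ 2 * HA * Ω + x * HA +
    (((Ptot - x) / 2) * Ω + 1) *
      (((Ptot - x) / 2) * HA + ((Ptot - x) / 2) * HB + x * Ω + 1)

lemma gammaFDDenom_pos {HA HB Ptot Ω x : ℝ} (hHA : 0 < HA) (hHB : 0 < HB) (hΩ : 0 ≤ Ω)
    (hx : x ∈ Set.Icc (0 : ℝ) Ptot) : 0 < gammaFDDenom HA HB Ptot Ω x := by
  have h0 : 0 ≤ x := hx.1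
  have h1 : 0 ≤ (Ptot - x) / 2 := by linarith [hx.2]
  unfold gammaFDDenom
  positivity

/-- The reciprocal of the SINR is, up to an additive constant, a positive combination of
`1 / x` and `1 / (Ptot - x)`; this is the resulting completed square for the denominator. -/
lemma sq_mul_gammaFDDenom (HA HB Ptot Ω : ℝ) {s t : ℝ}
    (hs : s ^ 2 = gammaFDDenom HA HB Ptot Ω 0) (ht : t ^ 2 = gammaFDDenom HA HB Ptot Ω Ptot) :
    ∃ K : ℝ, ∀ x : ℝ, Ptot ^ 2 * gammaFDDenom HA HB Ptot Ω x =
      K * (x * (Ptot - x)) + (s * (Ptot - x) - t * x) ^ 2 := by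
  refine ⟨(s + t) ^ 2 - (HA * Ω - Ω / 2 * (Ω - (HA + HB) / 2)) * Ptot ^ 2, fun x => ?_⟩
  unfold gammaFDDenom at *
  linear_combination (-Ptot * (Ptot - x)) * hs - Ptot * x * ht

theorem stmt_15 (HA HB Ptot Ω : ℝ) (hHA : 0 < HA) (hHB : 0 < HB) (hP : 0 < Ptot)
    (hΩ : 0 ≤ Ω) :
    ∃ xstar ∈ Set.Ioo (0 : ℝ) Ptot,
      (∀ x ∈ Set.Icc (0 : ℝ) Ptot, gammaFD HA HB Ptot Ω x ≤ gammaFD HA HB Ptot Ω xstar) ∧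
      ∀ y ∈ Set.Icc (0 : ℝ) Ptot,
        (∀ x ∈ Set.Icc (0 : ℝ) Ptot, gammaFD HA HB Ptot Ω x ≤ gammaFD HA HB Ptot Ω y) →
        y = xstar := by
  have hD0 := gammaFDDenom_pos hHA hHB hΩ (Set.left_mem_Icc.2 hP.le)
  have hDP := gammaFDDenom_pos hHA hHB hΩ (Set.right_mem_Icc.2 hP.le)
  obtain ⟨K, hK⟩ :=
    sq_mul_gammaFDDenom HA HB Ptot Ω (Real.sq_sqrt hD0.le) (Real.sq_sqrt hDP.le)
  have hs := Real.sqrt_pos.2 hD0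
  have ht := Real.sqrt_pos.2 hDP
  set s := √(gammaFDDenom HA HB Ptot Ω 0)
  set t := √(gammaFDDenom HA HB Ptot Ω Ptot)
  obtain ⟨z, hz⟩ : ∃ z, z = Ptot * s / (s + t) := ⟨_, rfl⟩
  have hzmul : z * (s + t) = Ptot * s := by rw [hz]; field_simp
  have hz0 : 0 < z := by rw [hz]; positivity
  have hzP : z < Ptot := by
    rw [hz, div_lt_iff₀ (by positivity)]
    nlinarith [mul_pos hP ht]
  have hroot : s * (Ptot - z) - t * z = 0 := by linear_combination -hzmul
  have hlt : ∀ y ∈ Set.Icc (0 : ℝ) Ptot, y ≠ z →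
      gammaFD HA HB Ptot Ω y < gammaFD HA HB Ptot Ω z := by
    intro y hy hyz
    have hne : s * (Ptot - y) - t * y ≠ 0 := by
      intro h
      exact hyz (mul_right_cancel₀ (add_pos hs ht).ne' (by linear_combination -h - hzmul))
    change (Ptot - y) / 2 * y * HA * HB / gammaFDDenom HA HB Ptot Ω y <
      (Ptot - z) / 2 * z * HA * HB / gammaFDDenom HA HB Ptot Ω z
    rw [div_lt_div_iff₀ (gammaFDDenom_pos hHA hHB hΩ hy)
      (gammaFDDenom_pos hHA hHB hΩ ⟨hz0.le, hzP.le⟩)]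
    have hKz := hK z
    rw [hroot] at hKz
    have hgap : 0 < HA * HB / 2 * (z * (Ptot - z)) * (s * (Ptot - y) - t * y) ^ 2 := by
      have := sub_pos.2 hzP
      positivity
    refine lt_of_mul_lt_mul_left (a := Ptot ^ 2) ?_ (sq_nonneg _)
    linear_combination hgap + (HA * HB / 2 * (y * (Ptot - y))) * hKz -
      (HA * HB / 2 * (z * (Ptot - z))) * hK y
  refine ⟨z, ⟨hz0, hzP⟩, fun x hx => ?_, fun y hy hmax => ?_⟩
  · rcases eq_or_ne x z with rfl | h
    · exact le_rfl
    · exact (hlt x hx h).le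
  · by_contra h
    exact (hlt y hy h).not_ge (hmax z ⟨hz0.le, hzP.le⟩)
end
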